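/- Consider the multiplex network: for 1 ≤ i ≤ N and 1 ≤ k ≤ K, the states x_i^k(t) ∈ ℝ^n evolve according to d/dt x_i^k(t) = f(x_i^k(t)) + c Σ_{j=1}^N a_{ij} x_j^k(t) + d Σ_{l=1}^K b_{kl} x_i^l(t) for all t ≥ 0, where f satisfies the QUAD condition with constant α, c, d ≥ 0, the intra-layer coupling matrix A = (a_{ij}) is a Laplacian-type coupling matrix with second-eigenvalue bound μ_2, and the inter-layer coupling matrix B = (b_{kl}) is a Laplacian-type coupling matrix with second-eigenvalue bound ν_2. If c μ_2 + α < 0 and d ν_2 + α < 0, then the multiplex network realizes complete synchronization: for all 1 ≤ i,j ≤ N and 1 ≤ k,l ≤ K, ‖x_i^k(t) − x_j^l(t)‖ tends to 0 as t → ∞. -/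

import Mathlib

open Filter Topology
open scoped RealInnerProductSpace

/-- The quadratic form bound transferred to vector-valued families. -/
lemma quad_vec {n N : ℕ} (A : Matrix (Fin N) (Fin N) ℝ) (μ : ℝ)
    (hμ : ∀ v : Fin N → ℝ, (∑ i, v i) = 0 →
      ∑ i, ∑ j, v i * A i j * v j ≤ μ * ∑ i, (v i) ^ 2)
    (y : Fin N → EuclideanSpace ℝ (Fin n)) (hy : ∑ i, y i = 0) :
    ∑ i, ∑ j, A i j * ⟪y i, y j⟫ ≤ μ * ∑ i, ‖y i‖ ^ 2 := by
  have h1 : ∑ i, ∑ j, A i j * ⟪y i, y j⟫ = ∑ m, ∑ i, ∑ j, y i m * A i j * y j m := by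
    rw [Finset.sum_comm]
    simp_rw [Finset.sum_comm (s := (Finset.univ : Finset (Fin n)))]
    rw [Finset.sum_comm]
    refine Finset.sum_congr rfl fun i _ => ?_
    rw [Finset.sum_comm]
    rw [Finset.sum_comm]
    refine Finset.sum_congr rfl fun j _ => ?_
    rw [PiLp.inner_apply, Finset.mul_sum]
    refine Finset.sum_congr rfl fun m _ => ?_
    simp
    ring
  have h2 : ∑ i, ‖y i‖ ^ 2 = ∑ m, ∑ i, (y i m) ^ 2 := by
    rw [Finset.sum_comm]
    refine Finset.sum_congr rfl fun i _ => ?_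
    rw [EuclideanSpace.norm_sq_eq]
    simp
  rw [h1, h2, Finset.mul_sum]
  refine Finset.sum_le_sum fun m _ => hμ (fun i => y i m) ?_
  have := congrArg (fun v : EuclideanSpace ℝ (Fin n) => v m) hy
  simpa using this

/-- A Laplacian-type matrix is negative semidefinite. -/
lemma lap_nonpos {n K : ℕ} (B : Matrix (Fin K) (Fin K) ℝ) (hs : B.IsSymm)
    (hrow : ∀ k, ∑ l, B k l = 0) (hoff : ∀ k l, k ≠ l → 0 ≤ B k l)
    (y : Fin K → EuclideanSpace ℝ (Fin n)) :
    ∑ k, ∑ l, B k l * ⟪y k, y l⟫ ≤ 0 := by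
  have h0 : 0 ≤ ∑ k, ∑ l, B k l * ‖y k - y l‖ ^ 2 := by
    refine Finset.sum_nonneg fun k _ => Finset.sum_nonneg fun l _ => ?_
    by_cases h : k = l
    · subst h; simp
    · exact mul_nonneg (hoff k l h) (by positivity)
  have e1 : ∑ k, ∑ l, B k l * ‖y k‖ ^ 2 = 0 := by
    simp_rw [← Finset.sum_mul, hrow]; simp
  have e2 : ∑ k, ∑ l, B k l * ‖y l‖ ^ 2 = 0 := by
    rw [Finset.sum_comm, ← e1]
    refine Finset.sum_congr rfl fun k _ => Finset.sum_congr rfl fun l _ => ?_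
    rw [hs.apply k l]
  have e3 : ∑ k, ∑ l, B k l * ‖y k - y l‖ ^ 2 = ∑ k, ∑ l, B k l * ‖y k‖ ^ 2
      + ∑ k, ∑ l, B k l * ‖y l‖ ^ 2 - 2 * ∑ k, ∑ l, B k l * ⟪y k, y l⟫ := by
    simp_rw [Finset.mul_sum, ← Finset.sum_add_distrib, ← Finset.sum_sub_distrib]
    refine Finset.sum_congr rfl fun k _ => Finset.sum_congr rfl fun l _ => ?_
    rw [norm_sub_sq_real]; ring
  linarith

/-- The pointwise dissipation inequality. -/
lemma dissip {n N K : ℕ}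
    (f : EuclideanSpace ℝ (Fin n) → EuclideanSpace ℝ (Fin n)) (α : ℝ)
    (hquad : ∀ x y : EuclideanSpace ℝ (Fin n), ⟪x - y, f x - f y⟫ ≤ α * ‖x - y‖ ^ 2)
    (c d : ℝ) (hc : 0 ≤ c) (hd : 0 ≤ d)
    (A : Matrix (Fin N) (Fin N) ℝ) (B : Matrix (Fin K) (Fin K) ℝ)
    (hBsym : B.IsSymm)
    (hArow : ∀ i, ∑ j, A i j = 0) (hBrow : ∀ k, ∑ l, B k l = 0)
    (hBoff : ∀ k l, k ≠ l → 0 ≤ B k l)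
    (μ₂ : ℝ)
    (hμ₂ : ∀ v : Fin N → ℝ, (∑ i, v i) = 0 →
      ∑ i, ∑ j, v i * A i j * v j ≤ μ₂ * ∑ i, (v i) ^ 2)
    (p y : Fin N → Fin K → EuclideanSpace ℝ (Fin n)) (b g : Fin K → EuclideanSpace ℝ (Fin n))
    (hy : ∀ i k, y i k = p i k - b k) (hy0 : ∀ k, ∑ i, y i k = 0) :
    ∑ k, ∑ i, ⟪y i k, (f (p i k) + c • ∑ j, A i j • p j k + d • ∑ l, B k l • p i l) - g k⟫
      ≤ (c * μ₂ + α) * ∑ k, ∑ i, ‖y i k‖ ^ 2 := by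
  have hz : ∀ k (v : EuclideanSpace ℝ (Fin n)), ∑ i, ⟪y i k, v⟫ = 0 := by
    intro k v
    rw [← sum_inner, hy0, inner_zero_left]
  have hp : ∀ i k, p i k = y i k + b k := fun i k => by rw [hy]; abel
  have hA : ∀ i k, ∑ j, A i j • p j k = ∑ j, A i j • y j k := by
    intro i k
    simp_rw [hp, smul_add, Finset.sum_add_distrib, ← Finset.sum_smul, hArow]
    simp
  have hB : ∀ i k, ∑ l, B k l • p i l = ∑ l, B k l • y i l + ∑ l, B k l • b l := by
    intro i k
    simp_rw [hp, smul_add, Finset.sum_add_distrib]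
  have key : ∀ k, ∑ i, ⟪y i k, (f (p i k) + c • ∑ j, A i j • p j k + d • ∑ l, B k l • p i l) - g k⟫
      = ∑ i, ⟪y i k, f (p i k) - f (b k)⟫ + c * ∑ i, ∑ j, A i j * ⟪y i k, y j k⟫
        + d * ∑ i, ∑ l, B k l * ⟪y i k, y i l⟫ := by
    intro k
    have hh : ∀ i, ⟪y i k, (f (p i k) + c • ∑ j, A i j • p j k + d • ∑ l, B k l • p i l) - g k⟫
      = ⟪y i k, f (p i k) - f (b k)⟫ + c * ∑ j, A i j * ⟪y i k, y j k⟫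
        + d * ∑ l, B k l * ⟪y i k, y i l⟫
        + ⟪y i k, f (b k) + d • ∑ l, B k l • b l - g k⟫ := by
      intro i
      rw [hA, hB]
      simp only [inner_sub_right, inner_add_right, inner_smul_right, inner_sum]
      ring
    simp_rw [hh, Finset.sum_add_distrib, hz, Finset.mul_sum]
    simp
  simp_rw [key, Finset.sum_add_distrib]
  have t1 : ∑ k, ∑ i, ⟪y i k, f (p i k) - f (b k)⟫ ≤ α * ∑ k, ∑ i, ‖y i k‖ ^ 2 := by
    simp_rw [Finset.mul_sum]
    refine Finset.sum_le_sum fun k _ => Finset.sum_le_sum fun i _ => ?_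
    rw [hy]; exact hquad _ _
  have t2 : ∑ k, c * ∑ i, ∑ j, A i j * ⟪y i k, y j k⟫ ≤ c * μ₂ * ∑ k, ∑ i, ‖y i k‖ ^ 2 := by
    rw [Finset.mul_sum]
    refine Finset.sum_le_sum fun k _ => ?_
    rw [mul_assoc]
    exact mul_le_mul_of_nonneg_left (quad_vec A μ₂ hμ₂ (fun i => y i k) (hy0 k)) hc
  have t3 : ∑ k, d * ∑ i, ∑ l, B k l * ⟪y i k, y i l⟫ ≤ 0 := by
    rw [← Finset.mul_sum, Finset.sum_comm]
    refine mul_nonpos_of_nonneg_of_nonpos hd (Finset.sum_nonpos fun i _ => ?_)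
    exact lap_nonpos B hBsym hBrow hBoff (fun k => y i k)
  linarith

/-- Exponential decay from a differential inequality. -/
lemma decay (V V' : ℝ → ℝ) (γ : ℝ) (hγ : γ < 0) (hV : ∀ t, 0 ≤ V t)
    (hd : ∀ t, 0 ≤ t → HasDerivAt V (V' t) t) (hle : ∀ t, 0 ≤ t → V' t ≤ γ * V t) :
    Tendsto V atTop (𝓝 0) := by
  have hW : ∀ t, 0 ≤ t → HasDerivAt (fun t => Real.exp (-γ * t) * V t)
      (Real.exp (-γ * t) * (-γ) * V t + Real.exp (-γ * t) * V' t) t := by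
    intro t ht
    have h1 : HasDerivAt (fun t => Real.exp (-γ * t)) (Real.exp (-γ * t) * (-γ)) t := by
      have := ((hasDerivAt_id t).const_mul (-γ)).exp
      simpa using this
    exact h1.mul (hd t ht)
  have hanti : AntitoneOn (fun t => Real.exp (-γ * t) * V t) (Set.Ici 0) := by
    refine antitoneOn_of_deriv_nonpos (convex_Ici 0)
      (fun t ht => (hW t ht).continuousAt.continuousWithinAt) ?_ ?_
    · intro t ht
      rw [interior_Ici] at ht
      exact (hW t (le_of_lt ht)).differentiableAt.differentiableWithinAt
    · intro t ht
      rw [interior_Ici] at ht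
      rw [(hW t (le_of_lt ht)).deriv]
      have := mul_le_mul_of_nonneg_left (hle t (le_of_lt ht)) (Real.exp_pos (-γ * t)).le
      nlinarith
  have hb : ∀ t, 0 ≤ t → V t ≤ Real.exp (γ * t) * V 0 := by
    intro t ht
    have h := hanti (Set.mem_Ici.2 le_rfl) (Set.mem_Ici.2 ht) ht
    simp only [mul_zero, Real.exp_zero, one_mul] at h
    calc V t = Real.exp (γ * t) * (Real.exp (-γ * t) * V t) := by
          rw [← mul_assoc, ← Real.exp_add]; simp
      _ ≤ _ := mul_le_mul_of_nonneg_left h (Real.exp_pos _).le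
  have hlim : Tendsto (fun t => Real.exp (γ * t) * V 0) atTop (𝓝 0) := by
    have : Tendsto (fun t : ℝ => γ * t) atTop atBot := tendsto_id.const_mul_atTop_of_neg hγ
    simpa using (Real.tendsto_exp_atBot.comp this).mul_const (V 0)
  refine tendsto_of_tendsto_of_tendsto_of_le_of_le' tendsto_const_nhds hlim
    (Eventually.of_forall hV) ?_
  filter_upwards [eventually_ge_atTop 0] with t ht using hb t ht

/-- Synchronization inside each layer. -/
lemma intra {n N K : ℕ}
    (f : EuclideanSpace ℝ (Fin n) → EuclideanSpace ℝ (Fin n)) (α : ℝ)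
    (hquad : ∀ x y : EuclideanSpace ℝ (Fin n), ⟪x - y, f x - f y⟫ ≤ α * ‖x - y‖ ^ 2)
    (c d : ℝ) (hc : 0 ≤ c) (hd : 0 ≤ d)
    (A : Matrix (Fin N) (Fin N) ℝ) (B : Matrix (Fin K) (Fin K) ℝ)
    (hBsym : B.IsSymm)
    (hArow : ∀ i, ∑ j, A i j = 0) (hBrow : ∀ k, ∑ l, B k l = 0)
    (hBoff : ∀ k l, k ≠ l → 0 ≤ B k l)
    (μ₂ : ℝ)
    (hμ₂ : ∀ v : Fin N → ℝ, (∑ i, v i) = 0 →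
      ∑ i, ∑ j, v i * A i j * v j ≤ μ₂ * ∑ i, (v i) ^ 2)
    (x : Fin N → Fin K → ℝ → EuclideanSpace ℝ (Fin n))
    (hode : ∀ i k, ∀ t : ℝ, 0 ≤ t → HasDerivAt (x i k)
      (f (x i k t) + c • ∑ j, A i j • x j k t + d • ∑ l, B k l • x i l t) t)
    (hsync₁ : c * μ₂ + α < 0) (i j : Fin N) (k : Fin K) :
    Tendsto (fun t : ℝ => ‖x i k t - x j k t‖) atTop (𝓝 0) := by
  have hN : (N : ℝ) ≠ 0 := by
    have := i.pos
    positivity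
  let F : Fin N → Fin K → ℝ → EuclideanSpace ℝ (Fin n) := fun i k t =>
    f (x i k t) + c • ∑ j, A i j • x j k t + d • ∑ l, B k l • x i l t
  let b : Fin K → ℝ → EuclideanSpace ℝ (Fin n) := fun k t => (N : ℝ)⁻¹ • ∑ i, x i k t
  let g : Fin K → ℝ → EuclideanSpace ℝ (Fin n) := fun k t => (N : ℝ)⁻¹ • ∑ i, F i k t
  let y : Fin N → Fin K → ℝ → EuclideanSpace ℝ (Fin n) := fun i k t => x i k t - b k t
  let V : ℝ → ℝ := fun t => ∑ k, ∑ i, ‖y i k t‖ ^ 2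
  have hyd : ∀ i k t, 0 ≤ t → HasDerivAt (y i k) (F i k t - g k t) t := by
    intro i k t ht
    refine (hode i k t ht).sub ?_
    exact (HasDerivAt.fun_sum fun i _ => hode i k t ht).fun_const_smul ((N : ℝ)⁻¹)
  have hVd : ∀ t, 0 ≤ t →
      HasDerivAt V (∑ k, ∑ i, 2 * ⟪y i k t, F i k t - g k t⟫) t := by
    intro t ht
    exact HasDerivAt.fun_sum fun k _ => HasDerivAt.fun_sum fun i _ => (hyd i k t ht).norm_sq
  have hy0 : ∀ t k, ∑ i, y i k t = 0 := by
    intro t k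
    simp only [y, b, Finset.sum_sub_distrib, Finset.sum_const, Finset.card_univ, Fintype.card_fin]
    rw [← Nat.cast_smul_eq_nsmul ℝ, smul_smul, mul_inv_cancel₀ hN, one_smul, sub_self]
  have hVlim : Tendsto V atTop (𝓝 0) := by
    refine decay V _ (2 * (c * μ₂ + α)) (by linarith) (fun t => by positivity) hVd ?_
    intro t ht
    have := dissip f α hquad c d hc hd A B hBsym hArow hBrow hBoff μ₂ hμ₂
      (fun i k => x i k t) (fun i k => y i k t) (fun k => b k t) (fun k => g k t)
      (fun i k => rfl) (hy0 t)
    simp_rw [← Finset.mul_sum]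
    rw [mul_assoc]
    exact mul_le_mul_of_nonneg_left this (by norm_num)
  have hylim : ∀ i, Tendsto (fun t => ‖y i k t‖) atTop (𝓝 0) := by
    intro i
    have hs : Tendsto (fun t => √(V t)) atTop (𝓝 0) := by
      simpa using hVlim.sqrt
    refine squeeze_zero (fun t => norm_nonneg _) (fun t => ?_) hs
    refine Real.le_sqrt_of_sq_le ?_
    calc ‖y i k t‖ ^ 2 ≤ ∑ i, ‖y i k t‖ ^ 2 :=
          Finset.single_le_sum (f := fun i => ‖y i k t‖ ^ 2)
            (fun _ _ => by positivity) (Finset.mem_univ i)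
      _ ≤ V t := Finset.single_le_sum (f := fun k => ∑ i, ‖y i k t‖ ^ 2)
            (fun _ _ => by positivity) (Finset.mem_univ k)
  have hsum := (hylim i).add (hylim j)
  rw [add_zero] at hsum
  refine squeeze_zero (fun t => norm_nonneg _) (fun t => ?_) hsum
  have : x i k t - x j k t = y i k t - y j k t := by simp [y]
  rw [this]
  exact norm_sub_le _ _

theorem multiplex_complete_synchronization
    (n N K : ℕ)
    (f : EuclideanSpace ℝ (Fin n) → EuclideanSpace ℝ (Fin n))
    (hf : Continuous f) (α : ℝ)
    (hquad : ∀ x y : EuclideanSpace ℝ (Fin n), ⟪x - y, f x - f y⟫ ≤ α * ‖x - y‖ ^ 2)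
    (c d : ℝ) (hc : 0 ≤ c) (hd : 0 ≤ d)
    (A : Matrix (Fin N) (Fin N) ℝ) (B : Matrix (Fin K) (Fin K) ℝ)
    (hAsym : A.IsSymm) (hBsym : B.IsSymm)
    (hArow : ∀ i, ∑ j, A i j = 0) (hBrow : ∀ k, ∑ l, B k l = 0)
    (hAoff : ∀ i j, i ≠ j → 0 ≤ A i j) (hBoff : ∀ k l, k ≠ l → 0 ≤ B k l)
    (μ₂ ν₂ : ℝ)
    (hμ₂ : ∀ v : Fin N → ℝ, (∑ i, v i) = 0 →
      ∑ i, ∑ j, v i * A i j * v j ≤ μ₂ * ∑ i, (v i) ^ 2)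
    (hν₂ : ∀ v : Fin K → ℝ, (∑ k, v k) = 0 →
      ∑ k, ∑ l, v k * B k l * v l ≤ ν₂ * ∑ k, (v k) ^ 2)
    (x : Fin N → Fin K → ℝ → EuclideanSpace ℝ (Fin n))
    (hode : ∀ i k, ∀ t : ℝ, 0 ≤ t → HasDerivAt (x i k)
      (f (x i k t) + c • ∑ j, A i j • x j k t + d • ∑ l, B k l • x i l t) t)
    (hsync₁ : c * μ₂ + α < 0) (hsync₂ : d * ν₂ + α < 0) :
    ∀ (i j : Fin N) (k l : Fin K),
      Tendsto (fun t : ℝ => ‖x i k t - x j l t‖) atTop (𝓝 0) := by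
  intro i j k l
  have h1 := intra f α hquad c d hc hd A B hBsym hArow hBrow hBoff μ₂ hμ₂ x hode hsync₁ i j k
  have h2 := intra f α hquad d c hd hc B A hAsym hBrow hArow hAoff ν₂ hν₂
    (fun k i => x i k) (fun k i t ht => by
      have := hode i k t ht
      rwa [add_right_comm] at this) hsync₂ k l j
  have hsum := h1.add h2
  rw [add_zero] at hsum
  refine squeeze_zero (fun t => norm_nonneg _) (fun t => ?_) hsum
  exact norm_sub_le_norm_sub_add_norm_sub _ _ _
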